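/- Let q > 2 be a prime power, let f be a permutation of 𝔽_q, and let f̂ be the unique extension of f to a permutation of ℙ¹(𝔽_q) fixing ∞. Then the Carlitz rank of f equals the smallest integer n ≥ 0 for which there exist b₁,…,b_n ∈ 𝔽_q and a permutation ν of ℙ¹(𝔽_q) induced by a degree-one rational function such that f̂ = ν ∘ (b₁,∞) ∘ (b₂,∞) ∘ ⋯ ∘ (b_n,∞). -/

import Mathlib

/-- A permutation of 𝔽_q is induced by a degree-one polynomial if it acts as x ↦ αx + β
for some α ≠ 0. -/
def IsAffinePerm {F : Type*} [Field F] (π : Equiv.Perm F) : Prop :=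
  ∃ α β : F, α ≠ 0 ∧ ∀ x, π x = α * x + β

/-- `f` admits a representation `f = θ₀ ∘ ρ ∘ θ₁ ∘ ρ ∘ ⋯ ∘ ρ ∘ θ_n` with each θᵢ induced
by a degree-one polynomial.  The Carlitz rank of `f` is the least such `n`. -/
def HasCRRep {F : Type*} [Field F] (ρ f : Equiv.Perm F) (n : ℕ) : Prop :=
  ∃ θ : Fin (n + 1) → Equiv.Perm F, (∀ i, IsAffinePerm (θ i)) ∧
    f = θ 0 * (List.ofFn (fun i : Fin n => ρ * θ i.succ)).prod

/-- The action of the degree-one rational function (αx+β)/(γx+δ) on ℙ¹(𝔽_q),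
modeled as `Option F` with `none` as ∞. -/
def mobiusFun {F : Type*} [Field F] [DecidableEq F] (α β γ δ : F) : Option F → Option F
  | none => if γ = 0 then none else some (α / γ)
  | some x => if γ * x + δ = 0 then none else some ((α * x + β) / (γ * x + δ))

/-- A permutation of ℙ¹(𝔽_q) is induced by a degree-one rational function if it acts as
some (αx+β)/(γx+δ) with αδ − βγ ≠ 0. -/
def IsMobius {F : Type*} [Field F] [DecidableEq F] (m : Equiv.Perm (Option F)) : Prop :=
  ∃ α β γ δ : F, α * δ - β * γ ≠ 0 ∧ ∀ x, m x = mobiusFun α β γ δ x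

theorem optionCongr_mul {α : Type*} (f g : Equiv.Perm α) :
    (f * g).optionCongr = f.optionCongr * g.optionCongr := by
  ext1 x
  cases x <;> rfl

theorem swap_mul_optionCongr {α : Type*} [DecidableEq α] (g : Equiv.Perm α) (a : α) :
    Equiv.swap (some (g a)) none * g.optionCongr
      = g.optionCongr * Equiv.swap (some a) none :=
  (Equiv.mul_swap_eq_swap_mul g.optionCongr (some a) none).symm

section CarlitzRank

variable {F : Type*} [Field F]

theorem IsAffinePerm.inv {π : Equiv.Perm F} (h : IsAffinePerm π) : IsAffinePerm π⁻¹ := by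
  obtain ⟨α, β, hα, h⟩ := h
  refine ⟨α⁻¹, -(α⁻¹ * β), inv_ne_zero hα, fun x => ?_⟩
  rw [Equiv.Perm.inv_eq_iff_eq, h]
  field_simp
  ring

theorem isAffinePerm_subRight (c : F) : IsAffinePerm (Equiv.subRight c) :=
  ⟨1, -c, one_ne_zero, fun x => by simp [sub_eq_add_neg]⟩

theorem hasCRRep_zero {ρ f : Equiv.Perm F} : HasCRRep ρ f 0 ↔ IsAffinePerm f := by
  constructor
  · rintro ⟨θ, hθ, rfl⟩
    simpa using hθ 0
  · intro h
    exact ⟨fun _ => f, fun _ => h, by simp⟩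

theorem hasCRRep_succ {ρ f : Equiv.Perm F} {n : ℕ} :
    HasCRRep ρ f (n + 1) ↔
      ∃ θ g : Equiv.Perm F, IsAffinePerm θ ∧ HasCRRep ρ g n ∧ f = θ * (ρ * g) := by
  constructor
  · rintro ⟨θ, hθ, rfl⟩
    exact ⟨θ 0, _, hθ 0, ⟨fun i => θ i.succ, fun i => hθ _, rfl⟩,
      by simp [List.ofFn_succ, mul_assoc]⟩
  · rintro ⟨θ₀, g, h₀, ⟨θ, hθ, rfl⟩, rfl⟩
    refine ⟨Fin.cons θ₀ θ, fun i => ?_, by simp [List.ofFn_succ, mul_assoc]⟩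
    refine Fin.cases ?_ (fun j => ?_) i
    · simpa using h₀
    · simpa using hθ j

variable [DecidableEq F]

theorem IsMobius.mul {m m' : Equiv.Perm (Option F)} (h : IsMobius m) (h' : IsMobius m') :
    IsMobius (m * m') := by
  obtain ⟨α, β, γ, δ, hd, h⟩ := h
  obtain ⟨α', β', γ', δ', hd', h'⟩ := h'
  refine ⟨α * α' + β * γ', α * β' + β * δ', γ * α' + δ * γ', γ * β' + δ * δ', ?_, ?_⟩
  · convert mul_ne_zero hd hd' using 1
    ring
  -- Both cases reduce to the action on the homogeneous coordinates `(u : v)` of the image.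
  have key : ∀ u v : F, ¬(u = 0 ∧ v = 0) →
      mobiusFun α β γ δ (if v = 0 then none else some (u / v)) =
        if γ * u + δ * v = 0 then none else some ((α * u + β * v) / (γ * u + δ * v)) := by
    intro u v huv
    by_cases hv : v = 0
    · have hu : u ≠ 0 := fun hu => huv ⟨hu, hv⟩
      simp [hv, mobiusFun, hu, mul_div_mul_right]
    · have e₁ : γ * (u / v) + δ = (γ * u + δ * v) / v := by field_simp
      have e₂ : α * (u / v) + β = (α * u + β * v) / v := by field_simp
      simp [hv, mobiusFun, e₁, e₂, div_div_div_cancel_right₀]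
  rintro (_ | x)
  · rw [Equiv.Perm.mul_apply, h', h]
    refine (key α' γ' ?_).trans rfl
    rintro ⟨h₁, h₂⟩
    simp [h₁, h₂] at hd'
  · rw [Equiv.Perm.mul_apply, h', h]
    refine (key (α' * x + β') (γ' * x + δ') ?_).trans ?_
    · rintro ⟨h₁, h₂⟩
      apply hd'
      by_cases hγ : γ' = 0
      · have : δ' = 0 := by simpa [hγ] using h₂
        simp [hγ, this]
      · refine (mul_eq_zero.mp ?_).resolve_left hγ
        linear_combination (γ' * α') * h₂ - γ' * γ' * h₁
    · have e₁ : γ * (α' * x + β') + δ * (γ' * x + δ') =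
          (γ * α' + δ * γ') * x + (γ * β' + δ * δ') := by ring
      have e₂ : α * (α' * x + β') + β * (γ' * x + δ') =
          (α * α' + β * γ') * x + (α * β' + β * δ') := by ring
      rw [e₁, e₂, mobiusFun]

theorem isMobius_optionCongr {f : Equiv.Perm F} :
    IsMobius f.optionCongr ↔ IsAffinePerm f := by
  constructor
  · rintro ⟨α, β, γ, δ, hd, h⟩
    have hγ : γ = 0 := by
      by_contra hγ
      simpa [mobiusFun, hγ] using h none
    subst hγ
    have hα : α ≠ 0 := by rintro rfl; simp at hd
    have hδ : δ ≠ 0 := by rintro rfl; simp at hd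
    refine ⟨α / δ, β / δ, div_ne_zero hα hδ, fun x => ?_⟩
    have := h (some x)
    simp only [mobiusFun, zero_mul, zero_add, if_neg hδ, Equiv.optionCongr_apply,
      Option.map_some, Option.some.injEq] at this
    rw [this]
    field_simp
  · rintro ⟨α, β, hα, h⟩
    refine ⟨α, β, 0, 1, by simpa using hα, ?_⟩
    rintro (_ | x) <;> simp [mobiusFun, h]

/-- `f̂ = ν ∘ (b₁,∞) ∘ ⋯ ∘ (b_n,∞)` for some Möbius `ν` and some `b₁, …, b_n`. -/
def HasTranspositionRep (m : Equiv.Perm (Option F)) (n : ℕ) : Prop :=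
  ∃ (ν : Equiv.Perm (Option F)) (b : Fin n → F), IsMobius ν ∧
    m = ν * (List.ofFn (fun i : Fin n => Equiv.swap (some (b i)) none)).prod

theorem hasTranspositionRep_zero {m : Equiv.Perm (Option F)} :
    HasTranspositionRep m 0 ↔ IsMobius m := by
  constructor
  · rintro ⟨ν, b, hν, rfl⟩
    simpa using hν
  · intro h
    exact ⟨m, Fin.elim0, h, by simp⟩

theorem hasTranspositionRep_succ {m : Equiv.Perm (Option F)} {n : ℕ} :
    HasTranspositionRep m (n + 1) ↔
      ∃ b : F, HasTranspositionRep (m * Equiv.swap (some b) none) n := by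
  constructor
  · rintro ⟨ν, b, hν, rfl⟩
    refine ⟨b (Fin.last n), ν, fun i => b i.castSucc, hν, ?_⟩
    rw [List.ofFn_succ', List.concat_eq_append]
    simp [mul_assoc]
  · rintro ⟨c, ν, b, hν, h⟩
    refine ⟨ν, Fin.snoc b c, hν, ?_⟩
    rw [List.ofFn_succ', List.concat_eq_append]
    simp [← mul_assoc, ← h]

theorem HasTranspositionRep.mul_left {μ m : Equiv.Perm (Option F)} {n : ℕ}
    (h : HasTranspositionRep m n) (hμ : IsMobius μ) : HasTranspositionRep (μ * m) n := by
  obtain ⟨ν, b, hν, rfl⟩ := h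
  exact ⟨μ * ν, b, hμ.mul hν, (mul_assoc _ _ _).symm⟩

variable {ρ : Equiv.Perm F}

theorem isMobius_optionCongr_mul_swap (hρ : ∀ a, ρ a = a⁻¹) :
    IsMobius (ρ.optionCongr * Equiv.swap (some 0) none) := by
  refine ⟨0, 1, 1, 0, by simp, ?_⟩
  rintro (_ | x)
  · simp [mobiusFun, hρ]
  · by_cases hx : x = 0
    · simp [hx, mobiusFun]
    · rw [Equiv.Perm.mul_apply, Equiv.swap_apply_of_ne_of_ne (by simpa using hx) (by simp)]
      simp [mobiusFun, hρ, hx]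

theorem hasCRRep_iff_hasTranspositionRep (hρ : ∀ a, ρ a = a⁻¹) {n : ℕ} {f : Equiv.Perm F} :
    HasCRRep ρ f n ↔ HasTranspositionRep f.optionCongr n := by
  induction n generalizing f with
  | zero => rw [hasCRRep_zero, hasTranspositionRep_zero, isMobius_optionCongr]
  | succ n ih =>
    have hJ := isMobius_optionCongr_mul_swap hρ
    rw [hasCRRep_succ, hasTranspositionRep_succ]
    constructor
    · rintro ⟨θ, g, hθ, hg, rfl⟩
      refine ⟨g⁻¹ 0, ?_⟩
      have hs := swap_mul_optionCongr g (g⁻¹ 0)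
      rw [show g (g⁻¹ 0) = 0 from g.apply_symm_apply 0] at hs
      rw [optionCongr_mul, optionCongr_mul, mul_assoc, mul_assoc, ← hs]
      simpa only [mul_assoc] using
        ((ih.mp hg).mul_left hJ).mul_left (isMobius_optionCongr.mpr hθ)
    · rintro ⟨b, hb⟩
      set t : Equiv.Perm F := Equiv.subRight (f b) with ht
      have hta : IsAffinePerm t := isAffinePerm_subRight _
      have hρρ : ρ * ρ = 1 := by
        ext x
        simp [hρ]
      refine ⟨t⁻¹, ρ * (t * f), hta.inv, ih.mpr ?_, ?_⟩
      · have h := (hb.mul_left (isMobius_optionCongr.mpr hta)).mul_left hJ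
        have hs := swap_mul_optionCongr (t * f) b
        have h0 : (t * f) b = 0 := by simp [ht]
        rw [h0, optionCongr_mul] at hs
        have e : ρ.optionCongr * Equiv.swap (some 0) none *
            (t.optionCongr * (f.optionCongr * Equiv.swap (some b) none))
            = (ρ * (t * f)).optionCongr := by
          rw [← mul_assoc t.optionCongr, ← hs, mul_assoc, Equiv.swap_mul_self_mul,
            optionCongr_mul, optionCongr_mul]
        rwa [e] at h
      · rw [← mul_assoc ρ, hρρ, one_mul, inv_mul_cancel_left]

end CarlitzRank

theorem pow_card_sub_two_eq_inv {F : Type*} [Field F] [Fintype F]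
    (hq : 2 < Fintype.card F) (a : F) : a ^ (Fintype.card F - 2) = a⁻¹ := by
  by_cases ha : a = 0
  · subst ha
    rw [zero_pow (by omega), inv_zero]
  · rw [← mul_eq_one_iff_eq_inv₀ ha, ← pow_succ, ← FiniteField.pow_card_sub_one_eq_one a ha]
    congr 1
    omega

/-- the Carlitz rank of a permutation f of 𝔽_q equals the least n ≥ 0 such
that the extension f̂ of f to ℙ¹(𝔽_q) fixing ∞ can be written as
f̂ = ν ∘ (b₁,∞) ∘ ⋯ ∘ (b_n,∞) for some b₁,…,b_n ∈ 𝔽_q and some permutation ν induced by a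
degree-one rational function. -/
theorem carlitzRank_eq_min_transposition_rep
    {F : Type*} [Field F] [Fintype F] [DecidableEq F]
    (hq : 2 < Fintype.card F)
    (ρ : Equiv.Perm F) (hρ : ∀ a : F, ρ a = a ^ (Fintype.card F - 2))
    (f : Equiv.Perm F) :
    sInf {n : ℕ | HasCRRep ρ f n}
      = sInf {n : ℕ | ∃ (ν : Equiv.Perm (Option F)) (b : Fin n → F), IsMobius ν ∧
          f.optionCongr
            = ν * (List.ofFn (fun i : Fin n => Equiv.swap (some (b i)) none)).prod} := by
  congr 1
  ext n
  exact hasCRRep_iff_hasTranspositionRep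
    (fun a => (hρ a).trans (pow_card_sub_two_eq_inv hq a))
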